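/- Let R be a semiprime right a-ring whose right socle is zero, i.e., Soc(R_R) = 0. Then R is strongly regular: for every a ∈ R there exists b ∈ R with a = a²b. -/

import Mathlib

/-- A module `M` over a ring `A` is *automorphism-invariant* if every injective
`A`-linear map from a submodule of `M` into `M` extends to an endomorphism of `M`. -/
def IsAutomorphismInvariant (A : Type*) [Ring A] (M : Type*) [AddCommGroup M]
    [Module A M] : Prop :=
  ∀ (N : Submodule A M) (f : N →ₗ[A] M), Function.Injective f →
    ∃ g : M →ₗ[A] M, ∀ n : N, g n = f n

/-- A module `M` over a ring `A` is *quasi-injective* if every `A`-linear map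
from a submodule of `M` into `M` extends to an endomorphism of `M`. -/
def IsQuasiInjective (A : Type*) [Ring A] (M : Type*) [AddCommGroup M]
    [Module A M] : Prop :=
  ∀ (N : Submodule A M) (f : N →ₗ[A] M), ∃ g : M →ₗ[A] M, ∀ n : N, g n = f n

/-- Right ideals of `R` are the `Rᵐᵒᵖ`-submodules of `R`.  A ring `R` is a *right
`a`-ring* if every right ideal of `R` is automorphism-invariant as a right `R`-module
(i.e. as an `Rᵐᵒᵖ`-module). -/
def IsRightARing (R : Type*) [Ring R] : Prop :=
  ∀ I : Submodule Rᵐᵒᵖ R, IsAutomorphismInvariant Rᵐᵒᵖ I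

/-- A ring `R` is a *right `q`-ring* if every right ideal of `R` is quasi-injective
as a right `R`-module. -/
def IsRightQRing (R : Type*) [Ring R] : Prop :=
  ∀ I : Submodule Rᵐᵒᵖ R, IsQuasiInjective Rᵐᵒᵖ I

/-- A right ideal is *essential* if it intersects every nonzero right ideal
nontrivially. -/
def IsEssentialRightIdeal (R : Type*) [Ring R] (I : Submodule Rᵐᵒᵖ R) : Prop :=
  ∀ J : Submodule Rᵐᵒᵖ R, I ⊓ J = ⊥ → J = ⊥

/-- The right ideal `eR` generated by an element `e`. -/
def rightIdealOf (R : Type*) [Ring R] (e : R) : Submodule Rᵐᵒᵖ R where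
  carrier := {x : R | ∃ r : R, x = e * r}
  zero_mem' := ⟨0, by simp⟩
  add_mem' := by rintro x y ⟨r, rfl⟩ ⟨s, rfl⟩; exact ⟨r + s, by rw [mul_add]⟩
  smul_mem' := by
    rintro c x ⟨r, rfl⟩
    exact ⟨r * c.unop, by rw [MulOpposite.smul_eq_mul_unop, mul_assoc]⟩

/-- The right annihilator of an element `a` of `R`, as a right ideal. -/
def rightAnnihilator (R : Type*) [Ring R] (a : R) : Submodule Rᵐᵒᵖ R where
  carrier := {r : R | a * r = 0}
  zero_mem' := by simp
  add_mem' := by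
    intro x y hx hy
    simp only [Set.mem_setOf_eq] at *
    rw [mul_add, hx, hy, add_zero]
  smul_mem' := by
    intro c x hx
    simp only [Set.mem_setOf_eq] at *
    rw [MulOpposite.smul_eq_mul_unop, ← mul_assoc, hx, zero_mul]

/-- The socle of a module: the sum of all its simple submodules. -/
def moduleSocle (A : Type*) [Ring A] (M : Type*) [AddCommGroup M] [Module A M] :
    Submodule A M :=
  sSup {N : Submodule A M | IsSimpleModule A N}

/-- A module is *square-free* if it contains no pair of nonzero independent
isomorphic submodules (equivalently, no nonzero submodule isomorphic to `X ⊕ X`). -/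
def IsSquareFreeModule (A : Type*) [Ring A] (M : Type*) [AddCommGroup M]
    [Module A M] : Prop :=
  ∀ N₁ N₂ : Submodule A M, N₁ ⊓ N₂ = ⊥ → Nonempty ((N₁ : Type _) ≃ₗ[A] N₂) → N₁ = ⊥

/-- A module `M` is *square-full* if every nonzero submodule of `M` contains a
nonzero submodule `N` such that `N ⊕ N` embeds in `M`. -/
def IsSquareFullModule (A : Type*) [Ring A] (M : Type*) [AddCommGroup M]
    [Module A M] : Prop :=
  ∀ U : Submodule A M, U ≠ ⊥ → ∃ N N₁ N₂ : Submodule A M, N ≠ ⊥ ∧ N ≤ U ∧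
    N₁ ⊓ N₂ = ⊥ ∧ Nonempty ((N : Type _) ≃ₗ[A] N₁) ∧ Nonempty ((N : Type _) ≃ₗ[A] N₂)

/-- A *CS module*: every submodule is essential in a direct summand. -/
def IsCSModule (A : Type*) [Ring A] (M : Type*) [AddCommGroup M] [Module A M] : Prop :=
  ∀ N : Submodule A M, ∃ D : Submodule A M, (∃ D' : Submodule A M, IsCompl D D') ∧
    N ≤ D ∧ ∀ K : Submodule A M, K ≤ D → K ⊓ N = ⊥ → K = ⊥

/-- A *weak CS module*: every semisimple submodule is essential in a direct summand. -/
def IsWeakCSModule (A : Type*) [Ring A] (M : Type*) [AddCommGroup M] [Module A M] : Prop :=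
  ∀ N : Submodule A M, IsSemisimpleModule A N → ∃ D : Submodule A M,
    (∃ D' : Submodule A M, IsCompl D D') ∧ N ≤ D ∧
      ∀ K : Submodule A M, K ≤ D → K ⊓ N = ⊥ → K = ⊥

/-- A *uniform module*: nonzero, and any two nonzero submodules intersect
nontrivially. -/
def IsUniformModule (A : Type*) [Ring A] (M : Type*) [AddCommGroup M] [Module A M] : Prop :=
  (⊤ : Submodule A M) ≠ ⊥ ∧ ∀ N₁ N₂ : Submodule A M, N₁ ≠ ⊥ → N₂ ≠ ⊥ → N₁ ⊓ N₂ ≠ ⊥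

/-- A ring is *semiprime* if it has no nonzero nilpotent two-sided ideal. -/
def IsSemiprimeRing (R : Type*) [Ring R] : Prop :=
  ∀ I : TwoSidedIdeal R, (∃ n : ℕ, n ≠ 0 ∧
    ∀ l : List R, l.length = n → (∀ x ∈ l, x ∈ I) → l.prod = 0) → I = ⊥

/-- A ring is *prime* if the product of any two nonzero two-sided ideals is nonzero. -/
def IsPrimeRing (R : Type*) [Ring R] : Prop :=
  ∀ I J : TwoSidedIdeal R, I ≠ ⊥ → J ≠ ⊥ → ∃ x ∈ I, ∃ y ∈ J, x * y ≠ 0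

/-- A ring is *von Neumann regular* if every element `a` satisfies `a = a * b * a`
for some `b`. -/
def IsVonNeumannRegularRing (R : Type*) [Ring R] : Prop :=
  ∀ a : R, ∃ b : R, a = a * b * a

section Module

variable {A : Type*} [Ring A]

theorem IsAutomorphismInvariant.of_linearEquiv {M M' : Type*} [AddCommGroup M] [Module A M]
    [AddCommGroup M'] [Module A M'] (e : M ≃ₗ[A] M') (h : IsAutomorphismInvariant A M') :
    IsAutomorphismInvariant A M := by
  intro N f hf
  obtain ⟨g, hg⟩ := h (N.map (e : M →ₗ[A] M'))
    ((e : M →ₗ[A] M') ∘ₗ f ∘ₗ ((e.submoduleMap N).symm : _ →ₗ[A] N))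
    (e.injective.comp (hf.comp (e.submoduleMap N).symm.injective))
  refine ⟨(e.symm : M' →ₗ[A] M) ∘ₗ g ∘ₗ (e : M →ₗ[A] M'), fun n => ?_⟩
  have hn := hg (e.submoduleMap N n)
  simp only [LinearEquiv.submoduleMap_apply, LinearMap.comp_apply, LinearEquiv.coe_coe,
    LinearEquiv.symm_apply_apply] at hn
  simp [hn]

theorem Submodule.exists_disjoint_sup_essential {M : Type*} [AddCommGroup M] [Module A M]
    (N : Submodule A M) :
    ∃ C : Submodule A M, Disjoint N C ∧ ∀ K, Disjoint (N ⊔ C) K → K = ⊥ := by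
  obtain ⟨C, hC⟩ := zorn_le₀ {C : Submodule A M | Disjoint N C} fun c hc hchain =>
    ⟨sSup c, hchain.directedOn.disjoint_sSup_right.2 fun _ hx => hc hx, fun z hz => le_sSup hz⟩
  refine ⟨C, hC.prop, fun K hK => ?_⟩
  have hle : C ⊔ K ≤ C :=
    hC.le_of_ge (Disjoint.disjoint_sup_right_of_disjoint_sup_left hC.prop hK) le_sup_left
  exact disjoint_self.1 (hK.mono_left ((le_sup_right.trans hle).trans le_sup_right))

theorem isSemisimpleModule_of_essential_eq_top {X : Type*} [AddCommGroup X] [Module A X]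
    (h : ∀ X' : Submodule A X, (∀ K, Disjoint X' K → K = ⊥) → X' = ⊤) :
    IsSemisimpleModule A X := by
  refine (isSemisimpleModule_iff A X).2 ⟨fun N => ?_⟩
  obtain ⟨C, hNC, hC⟩ := N.exists_disjoint_sup_essential
  exact ⟨C, hNC, codisjoint_iff.2 (h _ hC)⟩

theorem IsAutomorphismInvariant.apply_mem_of_essential {X Y : Type*} [AddCommGroup X] [Module A X]
    [AddCommGroup Y] [Module A Y] {X' : Submodule A X} (hX' : ∀ K, Disjoint X' K → K = ⊥)
    (h : IsAutomorphismInvariant A (X' × Y)) (f : Y →ₗ[A] X) (y : Y) : f y ∈ X' := by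
  let N : Submodule A (X' × Y) := (X'.comap f).comap (LinearMap.snd A X' Y)
  let φ : N →ₗ[A] X' × Y :=
    { toFun := fun n => (n.1.1 + ⟨f n.1.2, n.2⟩, n.1.2)
      map_add' := fun m n => by
        ext
        · simp; abel
        · simp
      map_smul' := fun c n => by ext <;> simp }
  have hφ : Function.Injective φ := by
    rintro ⟨⟨a, b⟩, hab⟩ ⟨⟨c, d⟩, hcd⟩ hEq
    obtain ⟨h₁, rfl⟩ := Prod.mk.inj hEq
    obtain rfl := add_right_cancel h₁
    rfl
  obtain ⟨g, hg⟩ := h N φ hφ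
  let d : Y →ₗ[A] X := X'.subtype ∘ₗ LinearMap.fst A X' Y ∘ₗ g ∘ₗ LinearMap.inr A X' Y - f
  have hd : ∀ y, d y = (g (0, y)).1 - f y := fun y => rfl
  have hbot : d.range = ⊥ := by
    refine hX' _ (Submodule.disjoint_def.2 ?_)
    rintro _ hx ⟨y, rfl⟩
    have hf : f y ∈ X' := by
      have := X'.sub_mem (g (0, y)).1.2 hx
      rwa [hd, sub_sub_cancel] at this
    have hgy := hg ⟨(0, y), hf⟩
    rw [hd, hgy]
    simp [φ]
  have hy : d y = 0 := by rw [LinearMap.range_eq_bot.1 hbot]; rfl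
  rw [hd, sub_eq_zero] at hy
  exact hy ▸ (g (0, y)).1.2

theorem linearMap_eq_zero_of_disjoint {M : Type*} [AddCommGroup M] [Module A M]
    (hM : ∀ N : Submodule A M, IsAutomorphismInvariant A N) (hsoc : moduleSocle A M = ⊥)
    {I J : Submodule A M} (hIJ : Disjoint I J) (f : J →ₗ[A] I) : f = 0 := by
  have hss : IsSemisimpleModule A f.range := by
    refine isSemisimpleModule_of_essential_eq_top fun X' hX' => ?_
    let k : X' →ₗ[A] M := I.subtype ∘ₗ f.range.subtype ∘ₗ X'.subtype
    have hk : Function.Injective k :=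
      I.injective_subtype.comp (f.range.injective_subtype.comp X'.injective_subtype)
    have hinj : Function.Injective (k.coprod J.subtype) := by
      refine (injective_iff_map_eq_zero _).2 fun ⟨x, y⟩ hxy => ?_
      replace hxy : k x + y = 0 := hxy
      have hy : (y : M) = 0 := Submodule.disjoint_def.1 hIJ y
        (eq_neg_of_add_eq_zero_right hxy ▸ I.neg_mem x.1.1.2) y.2
      rw [hy, add_zero] at hxy
      exact Prod.ext (hk (hxy.trans k.map_zero.symm)) (Subtype.ext hy)
    rw [eq_top_iff]
    rintro ⟨_, y, rfl⟩ -
    exact ((hM _).of_linearEquiv (LinearEquiv.ofInjective _ hinj)).apply_mem_of_essential hX'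
      f.rangeRestrict y
  by_contra hf
  have : Nontrivial f.range := by
    rw [Submodule.nontrivial_iff_ne_bot]
    exact fun h => hf (LinearMap.range_eq_bot.1 h)
  obtain ⟨S, hS⟩ := IsSemisimpleModule.exists_simple_submodule A f.range
  let k : f.range →ₗ[A] M := I.subtype ∘ₗ f.range.subtype
  have hk : Function.Injective k := I.injective_subtype.comp f.range.injective_subtype
  have e : S.map k ≃ₗ[A] S := (Submodule.equivMapOfInjective k hk S).symm
  have hS' : IsSimpleModule A (S.map k) := IsSimpleModule.congr (N := S) e
  have hle : S.map k ≤ moduleSocle A M := le_sSup hS'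
  rw [hsoc, le_bot_iff] at hle
  have := hS'.nontrivial
  exact (Submodule.nontrivial_iff_ne_bot.1 this) hle

end Module

section RightIdeal

variable {R : Type*} [Ring R]

theorem IsRightARing.exists_eq_mul (hR : IsRightARing R) {J : Submodule Rᵐᵒᵖ R}
    (f : J →ₗ[Rᵐᵒᵖ] R) (hf : Function.Injective f) : ∃ s : R, ∀ x : J, f x = s * x := by
  obtain ⟨g, hg⟩ := (hR ⊤).of_linearEquiv Submodule.topEquiv.symm J f hf
  refine ⟨g 1, fun x => ?_⟩
  have := g.map_smul (MulOpposite.op (x : R)) 1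
  rw [← hg x]
  simpa using this

theorem mem_rightAnnihilator {a x : R} : x ∈ rightAnnihilator R a ↔ a * x = 0 := Iff.rfl

theorem IsRightARing.mul_mem_of_essential (hR : IsRightARing R) {E : Submodule Rᵐᵒᵖ R}
    (hE : IsEssentialRightIdeal R E) {u : R} (hu : ∀ x, u * x = 0 → x = 0) {x : R} (hx : x ∈ E) :
    u * x ∈ E := by
  let l : E →ₗ[Rᵐᵒᵖ] R := LinearMap.mulLeft Rᵐᵒᵖ u ∘ₗ E.subtype
  let N : Submodule Rᵐᵒᵖ E := E.comap l
  have hinj : Function.Injective (l.restrict (p := N) (q := E) fun _ h => h) := by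
    refine (injective_iff_map_eq_zero _).2 fun n hn => ?_
    exact Subtype.ext (Subtype.ext (hu _ (congrArg Subtype.val hn)))
  obtain ⟨g, hg⟩ := hR E N _ hinj
  have hbot : (E.subtype ∘ₗ g - l).range = ⊥ := by
    refine hE _ (disjoint_iff.1 (Submodule.disjoint_def.2 ?_))
    rintro _ hy ⟨y, rfl⟩
    have hly : l y ∈ E := by
      have := E.sub_mem (g y).2 hy
      simpa using this
    have := congrArg Subtype.val (hg ⟨y, hly⟩)
    exact sub_eq_zero.2 this
  have h0 := LinearMap.congr_fun (LinearMap.range_eq_bot.1 hbot) ⟨x, hx⟩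
  have h1 : (g ⟨x, hx⟩ : R) = u * x := sub_eq_zero.1 h0
  exact h1 ▸ (g ⟨x, hx⟩).2

theorem IsEssentialRightIdeal.mono {E F : Submodule Rᵐᵒᵖ R} (hE : IsEssentialRightIdeal R E)
    (h : E ≤ F) : IsEssentialRightIdeal R F := fun J hJ =>
  hE J (le_bot_iff.1 ((inf_le_inf_right J h).trans hJ.le))

theorem IsEssentialRightIdeal.rightAnnihilator_mul_left {y : R}
    (hy : IsEssentialRightIdeal R (rightAnnihilator R y)) (w : R) :
    IsEssentialRightIdeal R (rightAnnihilator R (w * y)) :=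
  hy.mono fun x hx => by
    rw [mem_rightAnnihilator] at hx ⊢
    rw [mul_assoc, hx, mul_zero]

theorem IsEssentialRightIdeal.rightAnnihilator_mul_right {y : R}
    (hy : IsEssentialRightIdeal R (rightAnnihilator R y)) (w : R) :
    IsEssentialRightIdeal R (rightAnnihilator R (y * w)) := by
  intro K hK
  rw [← disjoint_iff, Submodule.disjoint_def] at hK
  have hbot : K.map (LinearMap.mulLeft Rᵐᵒᵖ w) = ⊥ := by
    refine hy _ (disjoint_iff.1 (Submodule.disjoint_def.2 ?_))
    rintro _ hx ⟨k, hk, rfl⟩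
    have : k = 0 := hK k (by rw [mem_rightAnnihilator, mul_assoc]; exact hx) hk
    simp [this]
  refine (Submodule.eq_bot_iff _).2 fun k hk => hK k ?_ hk
  have : w * k = 0 := (Submodule.eq_bot_iff _).1 hbot _ ⟨k, hk, rfl⟩
  rw [mem_rightAnnihilator, mul_assoc, this, mul_zero]

theorem IsSemiprimeRing.eq_zero_of_mul_mul_eq_zero (hsp : IsSemiprimeRing R) {x : R}
    (hx : ∀ r, x * r * x = 0) : x = 0 := by
  let I : TwoSidedIdeal R := TwoSidedIdeal.span {x}
  let P : TwoSidedIdeal R := TwoSidedIdeal.mk' {y | ∀ r, x * r * y = 0} (by simp)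
    (fun {y z} hy hz r => by rw [mul_add, hy, hz, add_zero])
    (fun {y} hy r => by rw [mul_neg, hy, neg_zero])
    (fun {s y} hy r => by rw [← mul_assoc, mul_assoc x r s, hy])
    (fun {y s} hy r => by rw [← mul_assoc, hy, zero_mul])
  have hP : I ≤ P := TwoSidedIdeal.span_le.2 (by simpa [P] using hx)
  let Q : TwoSidedIdeal R := TwoSidedIdeal.mk' {y | ∀ z ∈ I, ∀ r, y * r * z = 0} (by simp)
    (fun {y z} hy hz w hw r => by rw [add_mul, add_mul, hy w hw, hz w hw, add_zero])
    (fun {y} hy w hw r => by rw [neg_mul, neg_mul, hy w hw, neg_zero])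
    (fun {s y} hy w hw r => by rw [mul_assoc, mul_assoc, ← mul_assoc y, hy w hw, mul_zero])
    (fun {y s} hy w hw r => by rw [mul_assoc y, hy w hw])
  have hQ : I ≤ Q := TwoSidedIdeal.span_le.2 (by
    have : ∀ z ∈ I, ∀ r, x * r * z = 0 := fun z hz => by simpa [P] using hP hz
    simpa [Q] using this)
  have hI : I = ⊥ := by
    refine hsp I ⟨2, two_ne_zero, fun l hl hmem => ?_⟩
    obtain ⟨a, b, rfl⟩ := List.length_eq_two.1 hl
    have ha : ∀ z ∈ I, ∀ r, a * r * z = 0 := by simpa [Q] using hQ (hmem a (by simp))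
    simpa using ha b (hmem b (by simp)) 1
  have hxI : x ∈ I := TwoSidedIdeal.subset_span rfl
  rwa [hI, TwoSidedIdeal.mem_bot] at hxI

theorem IsRightARing.mul_mul_eq_zero_of_essential (hR : IsRightARing R) {z y c : R}
    (hz : IsEssentialRightIdeal R (rightAnnihilator R z))
    (hy : IsEssentialRightIdeal R (rightAnnihilator R y)) (hc : z * c = 0) : z * y * c = 0 := by
  have hinj : ∀ x, (1 - y) * x = 0 → x = 0 := by
    intro x hx
    have hbot : rightAnnihilator R (1 - y) = ⊥ := by
      refine hy _ (disjoint_iff.1 (Submodule.disjoint_def.2 fun x hx hx' => ?_))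
      rw [mem_rightAnnihilator] at hx hx'
      rwa [sub_mul, hx, one_mul, sub_zero] at hx'
    exact (Submodule.eq_bot_iff _).1 hbot x hx
  have h : z * ((1 - y) * c) = 0 := hR.mul_mem_of_essential hz hinj hc
  rwa [sub_mul, one_mul, mul_sub, hc, zero_sub, neg_eq_zero, ← mul_assoc] at h

theorem IsRightARing.eq_zero_of_essential_rightAnnihilator (hR : IsRightARing R)
    (hsp : IsSemiprimeRing R) {z : R} (hz : IsEssentialRightIdeal R (rightAnnihilator R z)) :
    z = 0 := by
  have hmul : ∀ y, IsEssentialRightIdeal R (rightAnnihilator R y) → z * y = 0 := by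
    intro y hy
    have hbot : rightIdealOf R (z * y) = ⊥ := by
      refine hz _ (disjoint_iff.1 (Submodule.disjoint_def.2 ?_))
      rintro _ hq ⟨t, rfl⟩
      refine hsp.eq_zero_of_mul_mul_eq_zero fun r => ?_
      have := hR.mul_mul_eq_zero_of_essential hz (hy.rightAnnihilator_mul_right (t * r)) hq
      simpa only [mul_assoc] using this
    exact (Submodule.eq_bot_iff _).1 hbot _ ⟨1, (mul_one _).symm⟩
  refine hsp.eq_zero_of_mul_mul_eq_zero fun r => ?_
  rw [mul_assoc]
  exact hmul _ (hz.rightAnnihilator_mul_left r)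

theorem IsRightARing.isReduced (hR : IsRightARing R) (hsp : IsSemiprimeRing R)
    (hsoc : moduleSocle Rᵐᵒᵖ R = ⊥) {a : R} (ha : a * a = 0) : a = 0 := by
  refine hR.eq_zero_of_essential_rightAnnihilator hsp fun B hB => ?_
  rw [← disjoint_iff] at hB
  let l : B →ₗ[Rᵐᵒᵖ] rightAnnihilator R a :=
    (LinearMap.mulLeft Rᵐᵒᵖ a ∘ₗ B.subtype).codRestrict _ fun b => by
      rw [mem_rightAnnihilator]
      simp [← mul_assoc, ha]
  have hl := linearMap_eq_zero_of_disjoint hR hsoc hB l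
  refine (Submodule.eq_bot_iff _).2 fun b hb => Submodule.disjoint_def.1 hB b ?_ hb
  exact congrArg Subtype.val (LinearMap.congr_fun hl ⟨b, hb⟩)

theorem IsRightARing.isVonNeumannRegularRing (hR : IsRightARing R) (hsp : IsSemiprimeRing R) :
    IsVonNeumannRegularRing R := by
  intro a
  obtain ⟨C, hC, hess⟩ := (rightAnnihilator R a).exists_disjoint_sup_essential
  let l : C →ₗ[Rᵐᵒᵖ] R := LinearMap.mulLeft Rᵐᵒᵖ a ∘ₗ C.subtype
  have hl : Function.Injective l :=
    (injective_iff_map_eq_zero _).2 fun c hc => Subtype.ext (Submodule.disjoint_def.1 hC c hc c.2)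
  let e := LinearEquiv.ofInjective l hl
  obtain ⟨s, hs⟩ := hR.exists_eq_mul (C.subtype ∘ₗ (e.symm : l.range →ₗ[Rᵐᵒᵖ] C))
    (C.injective_subtype.comp e.symm.injective)
  have hsC : ∀ c ∈ C, s * (a * c) = c := fun c hc => by
    have h := hs (e ⟨c, hc⟩)
    simp only [LinearMap.comp_apply, LinearEquiv.coe_coe, LinearEquiv.symm_apply_apply] at h
    exact h.symm
  refine ⟨s, sub_eq_zero.1 (hR.eq_zero_of_essential_rightAnnihilator hsp ?_)⟩
  have hE : IsEssentialRightIdeal R (rightAnnihilator R a ⊔ C) :=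
    fun K hK => hess K (disjoint_iff.2 hK)
  refine hE.mono (sup_le (fun x hx => ?_) fun x hx => ?_)
  · rw [mem_rightAnnihilator] at hx ⊢
    rw [sub_mul, mul_assoc, hx, mul_zero, sub_zero]
  · rw [mem_rightAnnihilator, sub_mul, mul_assoc, mul_assoc, hsC x hx, sub_self]

end RightIdeal

/-- a semiprime right `a`-ring with zero right socle is strongly
regular. -/
theorem semiprime_rightARing_zeroSocle_stronglyRegular (R : Type*) [Ring R]
    (hR : IsRightARing R) (hsp : IsSemiprimeRing R)
    (hsoc : moduleSocle Rᵐᵒᵖ R = ⊥) :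
    ∀ a : R, ∃ b : R, a = a ^ 2 * b := by
  intro a
  obtain ⟨s, hs⟩ := hR.isVonNeumannRegularRing hsp a
  refine ⟨s, sub_eq_zero.1 (hR.isReduced hsp hsoc ?_)⟩
  have h : (a - a ^ 2 * s) * a = 0 := by
    rw [sub_mul, pow_two, mul_assoc, mul_assoc, ← mul_assoc a s a, ← hs, sub_self]
  calc (a - a ^ 2 * s) * (a - a ^ 2 * s) = (a - a ^ 2 * s) * a * (1 - a * s) := by noncomm_ring
    _ = 0 := by rw [h, zero_mul]
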